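/- Let N ≥ 1 and 0 ≤ m < N. There exists C > 0 such that for every t > 0 and every measurable f : ℝ^N → ℝ with (1 + |x|^m) f ∈ L^∞(ℝ^N), the ℝ^N-valued function G(x) = ∫_{ℝ^N} ((x−y)/(2t)) (4πt)^{−N/2} e^{−|x−y|²/(4t)} f(y) dy (i.e. the spatial gradient of S(t)f) satisfies ‖(1 + |x|^m) |G(x)|‖_{L^∞(ℝ^N)} ≤ (C/√t) ‖(1 + |x|^m) f(x)‖_{L^∞(ℝ^N)}. -/

import Mathlib

open MeasureTheory Real

/-- The spatial gradient of the heat semigroup `S(t)f` on `ℝ^N` (for `t > 0`),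
`G(x) = ∫ ((x-y)/(2t)) (4πt)^{-N/2} e^{-|x-y|²/(4t)} f(y) dy`. -/
noncomputable def heatGrad (N : ℕ) (t : ℝ) (f : EuclideanSpace ℝ (Fin N) → ℝ)
    (x : EuclideanSpace ℝ (Fin N)) : EuclideanSpace ℝ (Fin N) :=
  ∫ y, ((4 * Real.pi * t) ^ (-(N : ℝ) / 2) * Real.exp (-‖x - y‖ ^ 2 / (4 * t)) * f y / (2 * t))
    • (x - y)

theorem rpow_mul_exp_neg_sq_div_four_le {p : ℝ} (hp : 0 ≤ p) :
    ∃ D > 0, ∀ r : ℝ, 0 ≤ r → r ^ p * exp (-r ^ 2 / 4) ≤ D * exp (-r ^ 2 / 8) := by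
  obtain ⟨k, hk⟩ := exists_nat_ge p
  refine ⟨(1 + k.factorial) * exp 2, by positivity, fun r hr => ?_⟩
  have h1 : r ^ p ≤ 1 + r ^ k := by
    rcases le_total r 1 with h | h
    · have := rpow_le_one hr h hp
      have : 0 ≤ r ^ k := by positivity
      linarith
    · have := rpow_le_rpow_of_exponent_le h hk
      rw [rpow_natCast] at this
      linarith
  have h2 : r ^ k ≤ k.factorial * exp r := by
    have := pow_div_factorial_le_exp r hr k
    rwa [div_le_iff₀' (by positivity)] at this
  have h3 : 1 ≤ exp r := one_le_exp hr
  have h4 : r ^ p ≤ (1 + k.factorial) * exp r := by linarith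
  calc r ^ p * exp (-r ^ 2 / 4) ≤ (1 + k.factorial) * exp r * exp (-r ^ 2 / 4) := by gcongr
    _ = (1 + k.factorial) * exp (r + -r ^ 2 / 4) := by rw [exp_add]; ring
    _ ≤ (1 + k.factorial) * exp (2 + -r ^ 2 / 8) :=
        mul_le_mul_of_nonneg_left (exp_le_exp.2 (by nlinarith [sq_nonneg (r - 4)]))
          (by positivity)
    _ = _ := by rw [exp_add]; ring

theorem integrable_exp_neg_norm_sq_div_eight (N : ℕ) :
    Integrable fun z : EuclideanSpace ℝ (Fin N) => exp (-‖z‖ ^ 2 / 8) := by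
  have h := GaussianFourier.integral_rexp_neg_mul_sq_norm (V := EuclideanSpace ℝ (Fin N))
    (b := 1 / 8) (by norm_num)
  have h' : Integrable fun z : EuclideanSpace ℝ (Fin N) => exp (-(1 / 8) * ‖z‖ ^ 2) := by
    by_contra hc
    rw [integral_undef hc] at h
    exact absurd h (by positivity)
  refine h'.congr (.of_forall fun z => ?_)
  ring_nf

theorem integrable_indicator_ball_norm_rpow_neg {N : ℕ} (hN : 1 ≤ N) {m : ℝ} (hm : m < N) :
    Integrable ((Metric.ball (0 : EuclideanSpace ℝ (Fin N)) 1).indicator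
      fun w => ‖w‖ ^ (-m)) := by
  rw [integrable_indicator_iff Metric.isOpen_ball.measurableSet]
  refine integrableOn_ball_of_norm_le_rpow (C := 1) (α := m) (by simpa using hN)
    (by simpa using hm) (.of_forall fun w => ?_)
    (Measurable.aestronglyMeasurable (by fun_prop))
  rw [norm_of_nonneg (by positivity), one_mul]

theorem one_add_mul_norm_rpow_le {E : Type*} [NormedAddCommGroup E] {m s : ℝ} (hm : 0 ≤ m)
    (hs : 0 ≤ s) (x : E) {w : E} (hw : w ≠ 0) :
    1 + s * ‖x‖ ^ m ≤
      (1 + s * ‖w‖ ^ m) * (1 + 2 ^ m + 2 ^ m * (‖x - w‖ ^ m * ‖w‖ ^ (-m))) := by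
  have hw' : 0 < ‖w‖ := norm_pos_iff.2 hw
  have hc : ‖w‖ ^ m * ‖w‖ ^ (-m) = 1 := by
    rw [← rpow_add hw', add_neg_cancel, rpow_zero]
  have h1 : ‖x‖ ^ m ≤ 2 ^ m * (‖x - w‖ ^ m + ‖w‖ ^ m) := by
    have h : ‖x‖ ≤ ‖x - w‖ + ‖w‖ := by simpa using norm_add_le (x - w) w
    rcases le_total ‖x - w‖ ‖w‖ with h' | h'
    · calc ‖x‖ ^ m ≤ (2 * ‖w‖) ^ m := by gcongr; linarith
        _ = 2 ^ m * ‖w‖ ^ m := mul_rpow (by norm_num) (norm_nonneg _)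
        _ ≤ _ := by gcongr; linarith [rpow_nonneg (norm_nonneg (x - w)) m]
    · calc ‖x‖ ^ m ≤ (2 * ‖x - w‖) ^ m := by gcongr; linarith
        _ = 2 ^ m * ‖x - w‖ ^ m := mul_rpow (by norm_num) (norm_nonneg _)
        _ ≤ _ := by gcongr; linarith [rpow_nonneg (norm_nonneg w) m]
  have h2 := mul_le_mul_of_nonneg_left h1 hs
  have h3 : 0 ≤ (2 : ℝ) ^ m + 2 ^ m * (‖x - w‖ ^ m * ‖w‖ ^ (-m)) + s * ‖w‖ ^ m := by positivity
  linear_combination h2 + h3 + s * 2 ^ m * ‖x - w‖ ^ m * hc.symm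

/-- The estimate at time one, uniformly over the weights `1 + s * ‖x‖ ^ m`. -/
theorem exists_heatGrad_one_bound {N : ℕ} (hN : 1 ≤ N) {m : ℝ} (hm0 : 0 ≤ m) (hm : m < N) :
    ∃ C > 0, ∀ s ≥ 0, ∀ (g : EuclideanSpace ℝ (Fin N) → ℝ) (M : ℝ),
      (∀ x, (1 + s * ‖x‖ ^ m) * |g x| ≤ M) →
      ∀ x, (1 + s * ‖x‖ ^ m) * ‖heatGrad N 1 g x‖ ≤ C * M := by
  have : Nonempty (Fin N) := ⟨⟨0, hN⟩⟩
  obtain ⟨D₁, hD₁, h₁⟩ := rpow_mul_exp_neg_sq_div_four_le zero_le_one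
  obtain ⟨D₂, hD₂, h₂⟩ := rpow_mul_exp_neg_sq_div_four_le (add_nonneg hm0 zero_le_one)
  set c : ℝ := 2 ^ m with hc
  have hc0 : 0 < c := by positivity
  set P : ℝ := (4 * π * 1) ^ (-(N : ℝ) / 2) with hP
  have hP0 : 0 < P := by positivity
  set B := (Metric.ball (0 : EuclideanSpace ℝ (Fin N)) 1).indicator fun w => ‖w‖ ^ (-m) with hB
  have hB0 : ∀ w, 0 ≤ B w := fun w => Set.indicator_nonneg (fun _ _ => by positivity) w
  have hBi : Integrable B := integrable_indicator_ball_norm_rpow_neg hN hm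
  have hGi := integrable_exp_neg_norm_sq_div_eight N
  set A : ℝ := (1 + c) * D₁ + c * D₂ with hA
  have hA0 : 0 < A := by positivity
  have hG0 : 0 ≤ ∫ z : EuclideanSpace ℝ (Fin N), exp (-‖z‖ ^ 2 / 8) :=
    integral_nonneg fun _ => by positivity
  have hBint : 0 ≤ ∫ w, B w := integral_nonneg hB0
  refine ⟨P / 2 * (A * (∫ z : EuclideanSpace ℝ (Fin N), exp (-‖z‖ ^ 2 / 8))
    + c * D₂ * ∫ w, B w) + 1, by positivity, fun s hs g M hg x => ?_⟩
  have hM : 0 ≤ M := le_trans (by positivity) (hg 0)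
  have hW : 0 < 1 + s * ‖x‖ ^ m := by positivity
  have hGx : Integrable fun w => exp (-‖x - w‖ ^ 2 / 8) := hGi.comp_sub_left x
  have key : ‖(1 + s * ‖x‖ ^ m) • heatGrad N 1 g x‖ ≤
      ∫ w, M * (P / 2 * (A * exp (-‖x - w‖ ^ 2 / 8) + c * D₂ * B w)) := by
    rw [heatGrad, ← integral_smul]
    refine norm_integral_le_of_norm_le
      ((((hGx.const_mul A).add (hBi.const_mul (c * D₂))).const_mul (P / 2)).const_mul M) ?_
    filter_upwards [Measure.ae_ne volume (0 : EuclideanSpace ℝ (Fin N))] with w hw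
    have hw' : 0 < ‖w‖ := norm_pos_iff.2 hw
    set r := ‖x - w‖ with hr
    have hr0 : 0 ≤ r := norm_nonneg _
    have e1 := h₁ r hr0
    have e2 := h₂ r hr0
    rw [rpow_one] at e1
    rw [rpow_add_one' hr0 (by positivity)] at e2
    have hq0 : 0 ≤ ‖w‖ ^ (-m) := by positivity
    have e3 : exp (-r ^ 2 / 8) * ‖w‖ ^ (-m) ≤ exp (-r ^ 2 / 8) + B w := by
      by_cases hb : w ∈ Metric.ball (0 : EuclideanSpace ℝ (Fin N)) 1
      · have : exp (-r ^ 2 / 8) ≤ 1 := exp_le_one_iff.2 (by nlinarith [sq_nonneg r])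
        rw [hB, Set.indicator_of_mem hb]
        nlinarith [exp_pos (-r ^ 2 / 8)]
      · have h1w : 1 ≤ ‖w‖ := by simpa using hb
        have : ‖w‖ ^ (-m) ≤ 1 := rpow_le_one_of_one_le_of_nonpos h1w (by linarith)
        nlinarith [exp_pos (-r ^ 2 / 8), hB0 w]
    have e4 : (1 + s * ‖x‖ ^ m) * |g w| ≤ M * (1 + c + c * (r ^ m * ‖w‖ ^ (-m))) := by
      calc (1 + s * ‖x‖ ^ m) * |g w|
          ≤ ((1 + s * ‖w‖ ^ m) * (1 + c + c * (r ^ m * ‖w‖ ^ (-m)))) * |g w| := by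
            gcongr
            exact one_add_mul_norm_rpow_le hm0 hs x hw
        _ = ((1 + s * ‖w‖ ^ m) * |g w|) * (1 + c + c * (r ^ m * ‖w‖ ^ (-m))) := by ring
        _ ≤ _ := by gcongr; exact hg w
    rw [norm_smul, norm_smul, norm_of_nonneg hW.le, norm_div, norm_mul, norm_mul,
      norm_of_nonneg hP0.le, norm_of_nonneg (exp_pos _).le, norm_eq_abs (g w), ← hr,
      norm_of_nonneg (by norm_num : (0 : ℝ) ≤ 2 * 1), mul_one, mul_one]
    calc (1 + s * ‖x‖ ^ m) * (P * exp (-r ^ 2 / 4) * |g w| / 2 * r)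
        = ((1 + s * ‖x‖ ^ m) * |g w|) * (P / 2 * (r * exp (-r ^ 2 / 4))) := by ring
      _ ≤ M * (1 + c + c * (r ^ m * ‖w‖ ^ (-m))) * (P / 2 * (r * exp (-r ^ 2 / 4))) := by gcongr
      _ = M * (P / 2 * ((1 + c) * (r * exp (-r ^ 2 / 4))
          + c * (r ^ m * r * exp (-r ^ 2 / 4) * ‖w‖ ^ (-m)))) := by ring
      _ ≤ M * (P / 2 * ((1 + c) * (D₁ * exp (-r ^ 2 / 8))
          + c * (D₂ * exp (-r ^ 2 / 8) * ‖w‖ ^ (-m)))) := by gcongr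
      _ = M * (P / 2 * ((1 + c) * (D₁ * exp (-r ^ 2 / 8))
          + c * D₂ * (exp (-r ^ 2 / 8) * ‖w‖ ^ (-m)))) := by ring
      _ ≤ M * (P / 2 * ((1 + c) * (D₁ * exp (-r ^ 2 / 8))
          + c * D₂ * (exp (-r ^ 2 / 8) + B w))) := by gcongr
      _ = _ := by rw [hA]; ring
  rw [norm_smul, norm_of_nonneg hW.le, integral_const_mul, integral_const_mul,
    integral_add (hGx.const_mul A) (hBi.const_mul _), integral_const_mul, integral_const_mul,
    integral_sub_left_eq_self (fun z : EuclideanSpace ℝ (Fin N) => exp (-‖z‖ ^ 2 / 8))] at key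
  linarith

/-- Parabolic scaling of the gradient of the heat semigroup. -/
theorem heatGrad_eq_smul_heatGrad_one (N : ℕ) {s : ℝ} (hs : 0 < s)
    (f : EuclideanSpace ℝ (Fin N) → ℝ) (x : EuclideanSpace ℝ (Fin N)) :
    heatGrad N (s ^ 2) f (s • x) = s⁻¹ • heatGrad N 1 (fun w => f (s • w)) x := by
  have h := Measure.integral_comp_smul_of_nonneg volume (fun y =>
    ((4 * π * s ^ 2) ^ (-(N : ℝ) / 2) * exp (-‖s • x - y‖ ^ 2 / (4 * s ^ 2)) * f y / (2 * s ^ 2))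
      • (s • x - y)) s (hR := hs.le)
  rw [finrank_euclideanSpace_fin, eq_inv_smul_iff₀ (by positivity)] at h
  rw [heatGrad, heatGrad, ← h, ← integral_smul, ← integral_smul]
  congr 1 with w : 1
  have hpow : (s ^ 2) ^ (-(N : ℝ) / 2) = (s ^ N)⁻¹ := by
    rw [← rpow_natCast s 2, ← rpow_mul hs.le, ← rpow_natCast s N, ← rpow_neg hs.le]
    congr 1
    push_cast
    ring
  have hexp : -‖s • x - s • w‖ ^ 2 / (4 * s ^ 2) = -‖x - w‖ ^ 2 / (4 * 1) := by
    rw [← smul_sub, norm_smul, norm_of_nonneg hs.le]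
    field_simp
  rw [hexp, mul_rpow (by positivity) (by positivity), hpow, ← smul_sub, smul_smul, smul_smul,
    smul_smul, mul_one (4 * π)]
  congr 1
  field_simp

theorem stmt_7 (N : ℕ) (hN : 1 ≤ N) (m : ℝ) (hm0 : 0 ≤ m) (hm : m < N) :
    ∃ C > 0, ∀ t > 0, ∀ (f : EuclideanSpace ℝ (Fin N) → ℝ) (M : ℝ),
      Measurable f → (∀ x, (1 + ‖x‖ ^ m) * |f x| ≤ M) →
      ∀ x, (1 + ‖x‖ ^ m) * ‖heatGrad N t f x‖ ≤ C / Real.sqrt t * M := by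
  obtain ⟨C, hC, h⟩ := exists_heatGrad_one_bound hN hm0 hm
  refine ⟨C, hC, fun t ht f M _ hf x => ?_⟩
  obtain ⟨s, hs, rfl⟩ : ∃ s > 0, s ^ 2 = t := ⟨√t, sqrt_pos.2 ht, sq_sqrt ht.le⟩
  obtain ⟨ξ, rfl⟩ : ∃ ξ, s • ξ = x := ⟨s⁻¹ • x, smul_inv_smul₀ hs.ne' x⟩
  have hw : ∀ z : EuclideanSpace ℝ (Fin N), ‖s • z‖ ^ m = s ^ m * ‖z‖ ^ m := fun z => by
    rw [norm_smul, norm_of_nonneg hs.le, mul_rpow hs.le (norm_nonneg z)]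
  have h1 := h (s ^ m) (by positivity) (fun w => f (s • w)) M
    (fun w => by simpa only [hw] using hf (s • w)) ξ
  rw [sqrt_sq hs.le, heatGrad_eq_smul_heatGrad_one N hs, hw, norm_smul,
    norm_of_nonneg (by positivity)]
  calc _ = s⁻¹ * ((1 + s ^ m * ‖ξ‖ ^ m) * ‖heatGrad N 1 (fun w => f (s • w)) ξ‖) := by ring
    _ ≤ s⁻¹ * (C * M) := by gcongr
    _ = _ := by ring
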